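/- Let D be a byte pair dictionary, and let v, w be strings with 𝕋^D(v) = τ₁⌢u⌢τ₂ and 𝕋^D(w) = φ₁⌢u⌢φ₂ for the same token u and (possibly empty) tokenizations τ₁, τ₂, φ₁, φ₂. Then 𝕋^D(π(τ₁⌢u⌢φ₂)) = τ₁⌢u⌢φ₂ and 𝕋^D(π(φ₁⌢u⌢τ₂)) = φ₁⌢u⌢τ₂. -/

import Mathlib

/-!
Formalization of byte pair encoding (BPE) tokenization semantics.

* The alphabet is a type `α`.
* A *token* is a (intended nonempty) string over `α`, i.e. a `List α`.
* A *tokenization* is a finite sequence of tokens.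
* A *byte pair dictionary* is a finite sequence of rules (pairs of tokens),
  listed in order of decreasing priority.
-/

/-- A token: a string over the alphabet `α`. -/
abbrev Token (α : Type*) := List α

/-- A tokenization: a finite sequence of tokens. -/
abbrev Tok (α : Type*) := List (Token α)

/-- A byte pair dictionary: a finite sequence of rules, in decreasing priority order. -/
abbrev Dict (α : Type*) := List (Token α × Token α)

variable {α : Type*}

/-- `π`: concatenation of the tokens of a tokenization. -/
def pi (τ : Tok α) : List α := τ.flatten

/-- All tokens of a tokenization are nonempty strings. -/
def NETok (τ : Tok α) : Prop := ∀ u ∈ τ, u ≠ []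

/-- All rules of a dictionary consist of nonempty tokens. -/
def NEDict (D : Dict α) : Prop := ∀ r ∈ D, r.1 ≠ [] ∧ r.2 ≠ []

/-- `Tk∅(w)`: the initial tokenization of `w` into single symbols. -/
def TkEmpty (w : List α) : Tok α := w.map (fun a => [a])

/-- Rule `r` applies in tokenization `τ` at position `p`
(i.e. `τ = φ ⌢ r.1 ⌢ r.2 ⌢ φ'` with `|φ| = p`). -/
def AppliesAt (r : Token α × Token α) (τ : Tok α) (p : ℕ) : Prop :=
  ∃ φ φ' : Tok α, φ.length = p ∧ τ = φ ++ r.1 :: r.2 :: φ'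

/-- Rule `r` applies somewhere in tokenization `τ`. -/
def Applies (r : Token α × Token α) (τ : Tok α) : Prop := ∃ p, AppliesAt r τ p

/-- The result of applying (merging by) rule `r` at position `p` in `τ`. -/
def applyAt (r : Token α × Token α) (τ : Tok α) (p : ℕ) : Tok α :=
  τ.take p ++ (r.1 ++ r.2) :: τ.drop (p + 2)

/-- The base (nondeterministic) rewriting step `τ ⇒ τ'`: some rule of `D`
is applied somewhere in `τ`. -/
def BStep (D : Dict α) (τ τ' : Tok α) : Prop :=
  ∃ (φ φ' : Tok α) (u v : Token α),
    (u, v) ∈ D ∧ τ = φ ++ u :: v :: φ' ∧ τ' = φ ++ (u ++ v) :: φ'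

/-- `τ` is a base tokenization of `w`: reachable from `Tk∅(w)` by base steps,
and no rule of `D` applies to it. -/
def IsBase (D : Dict α) (w : List α) (τ : Tok α) : Prop :=
  Relation.ReflTransGen (BStep D) (TkEmpty w) τ ∧ ∀ τ', ¬ BStep D τ τ'

/-- `BStepN D n τ τ'`: `τ'` is obtained from `τ` by exactly `n` base steps. -/
def BStepN (D : Dict α) : ℕ → Tok α → Tok α → Prop
  | 0 => Eq
  | n + 1 => fun τ τ'' => ∃ τ', BStepN D n τ τ' ∧ BStep D τ' τ''

/-- One SentencePiece step applying the rule of index `i` (highest priority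
applicable) at position `p` (leftmost occurrence of that rule). -/
def SPStepAt (D : Dict α) (i p : ℕ) (τ τ' : Tok α) : Prop :=
  ∃ h : i < D.length,
    AppliesAt (D[i]'h) τ p ∧
    (∀ (j : ℕ) (hj : j < D.length), j < i → ¬ Applies (D[j]'hj) τ) ∧
    (∀ q < p, ¬ AppliesAt (D[i]'h) τ q) ∧
    τ' = applyAt (D[i]'h) τ p

/-- One SentencePiece step: the highest priority applicable rule is applied
at its leftmost occurrence. -/
def SPStep (D : Dict α) (τ τ' : Tok α) : Prop := ∃ i p, SPStepAt D i p τ τ'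

/-- One SentencePiece step which applies the rule `r` of `D`. -/
def SPStepRule (D : Dict α) (r : Token α × Token α) (τ τ' : Tok α) : Prop :=
  ∃ (i p : ℕ) (h : i < D.length), D[i]'h = r ∧ SPStepAt D i p τ τ'

/-- `τ` is the SentencePiece tokenization `𝕋^D(w)` of `w`: reachable from
`Tk∅(w)` by SentencePiece steps, and no further step applies. -/
def IsSP (D : Dict α) (w : List α) (τ : Tok α) : Prop :=
  Relation.ReflTransGen (SPStep D) (TkEmpty w) τ ∧ ∀ τ', ¬ SPStep D τ τ'

/-- One application of rule `r` at its leftmost occurrence. -/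
def LeftStep (r : Token α × Token α) (τ τ' : Tok α) : Prop :=
  ∃ p, AppliesAt r τ p ∧ (∀ q < p, ¬ AppliesAt r τ q) ∧ τ' = applyAt r τ p

/-- Exhaustive application of rule `r`, leftmost first, until it no longer applies. -/
def Exhaust (r : Token α × Token α) (τ τ' : Tok α) : Prop :=
  Relation.ReflTransGen (LeftStep r) τ τ' ∧ ¬ Applies r τ'

/-- One HuggingFace (macro) step using the rule of index `i`: the rule of
index `i` is the highest-priority applicable rule, and it is applied
repeatedly at its leftmost occurrence until it no longer applies. -/
def HFStepAt (D : Dict α) (i : ℕ) (τ τ' : Tok α) : Prop :=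
  ∃ h : i < D.length,
    Applies (D[i]'h) τ ∧
    (∀ (j : ℕ) (hj : j < D.length), j < i → ¬ Applies (D[j]'hj) τ) ∧
    Exhaust (D[i]'h) τ τ'

/-- One HuggingFace (macro) step. -/
def HFStep (D : Dict α) (τ τ' : Tok α) : Prop := ∃ i, HFStepAt D i τ τ'

/-- One HuggingFace (macro) step which uses the rule `r` of `D`. -/
def HFStepRule (D : Dict α) (r : Token α × Token α) (τ τ' : Tok α) : Prop :=
  ∃ (i : ℕ) (h : i < D.length), D[i]'h = r ∧ HFStepAt D i τ τ'

/-- `τ` is the HuggingFace tokenization `𝕋_hf^D(w)` of `w`. -/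
def IsHF (D : Dict α) (w : List α) (τ : Tok α) : Prop :=
  Relation.ReflTransGen (HFStep D) (TkEmpty w) τ ∧ ∀ τ', ¬ HFStep D τ τ'

/-- A dictionary is *proper* if each side of each rule of length `> 1` is
produced by some higher-priority rule. -/
def Proper (D : Dict α) : Prop :=
  ∀ (j : ℕ) (hj : j < D.length),
    (1 < (D[j]'hj).1.length →
      ∃ (i : ℕ) (hi : i < D.length), i < j ∧ (D[j]'hj).1 = (D[i]'hi).1 ++ (D[i]'hi).2) ∧
    (1 < (D[j]'hj).2.length →
      ∃ (i : ℕ) (hi : i < D.length), i < j ∧ (D[j]'hj).2 = (D[i]'hi).1 ++ (D[i]'hi).2)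

/-- `max{|uv| : u⌢v ∈ D}`: the maximal total length of a rule of `D`. -/
def maxPairLen (D : Dict α) : ℕ := (D.map (fun r => (r.1 ++ r.2).length)).foldr max 0

/-- `l` is a sufficient lookahead bound for `D`: whenever `𝕋^D(π(φ)π(τ)) = φ⌢τ` with
`|π(τ)| ≥ l`, appending any further text keeps `φ` as a prefix of the tokenization. -/
def GoodLookahead (D : Dict α) (l : ℕ) : Prop :=
  ∀ φ τ ψ : Tok α, l ≤ (pi τ).length →
    IsSP D (pi φ ++ pi τ) (φ ++ τ) →
    ∃ ψ', IsSP D (pi φ ++ pi τ ++ pi ψ) (φ ++ ψ')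

/-- The lookahead constant `l(D)`: the smallest sufficient lookahead bound. -/
noncomputable def lookaheadConst (D : Dict α) : ℕ := sInf {l | GoodLookahead D l}

open Relation

theorem pi_append (a b : Tok α) : pi (a ++ b) = pi a ++ pi b := by simp [pi]

theorem pi_cons (t : Token α) (a : Tok α) : pi (t :: a) = t ++ pi a := by simp [pi]

theorem pi_tkEmpty (w : List α) : pi (TkEmpty w) = w := by
  induction w with
  | nil => rfl
  | cons a w ih => simpa [pi, TkEmpty] using ih

theorem tkEmpty_append (v w : List α) : TkEmpty (v ++ w) = TkEmpty v ++ TkEmpty w := by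
  simp [TkEmpty]

theorem neTok_tkEmpty (w : List α) : NETok (TkEmpty w) := by
  intro t ht
  simp only [TkEmpty, List.mem_map] at ht
  obtain ⟨a, -, rfl⟩ := ht
  simp

theorem neTok_append {a b : Tok α} : NETok (a ++ b) ↔ NETok a ∧ NETok b := by
  simp only [NETok, List.mem_append, or_imp, forall_and]

theorem NETok.eq_nil_of_pi_eq_nil {a : Tok α} (ha : NETok a) (h : pi a = []) : a = [] := by
  cases a with
  | nil => rfl
  | cons t a => exact absurd (List.append_eq_nil_iff.1 (pi_cons t a ▸ h)).1 (ha t (by simp))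

/-- A split of a tokenization is determined by the text of its left part. -/
theorem eq_of_append_eq_append_of_pi_eq {a b a' b' : Tok α} (hne : NETok (a ++ b))
    (h : a ++ b = a' ++ b') (hpi : pi a = pi a') : a = a' ∧ b = b' := by
  obtain ⟨m, rfl, rfl⟩ | ⟨m, rfl, rfl⟩ := List.append_eq_append_iff.1 h
  · have hm : m = [] := NETok.eq_nil_of_pi_eq_nil
      (neTok_append.1 (neTok_append.1 hne).2).1 (by simpa [pi_append] using hpi)
    simp [hm]
  · have hm : m = [] := NETok.eq_nil_of_pi_eq_nil
      (neTok_append.1 (neTok_append.1 hne).1).2 (by simpa [pi_append] using hpi)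
    simp [hm]

/-- An adjacent pair in `a ++ b` lies in `a`, straddles the boundary, or lies in `b`. -/
theorem pair_append_cases {φ φ' a b : Tok α} {s t : Token α} (h : a ++ b = φ ++ s :: t :: φ') :
    (∃ m, a = φ ++ s :: t :: m ∧ φ' = m ++ b) ∨ (a = φ ++ [s] ∧ b = t :: φ') ∨
      ∃ m, φ = a ++ m ∧ b = m ++ s :: t :: φ' := by
  obtain ⟨m, rfl, rfl⟩ | ⟨m, rfl, hm⟩ := List.append_eq_append_iff.1 h
  · exact .inr (.inr ⟨m, rfl, rfl⟩)
  · rcases m with _ | ⟨s', _ | ⟨t', m⟩⟩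
    · exact .inr (.inr ⟨[], by simp, by simpa using hm.symm⟩)
    · simp only [List.cons_append, List.nil_append, List.cons.injEq] at hm
      exact .inr (.inl ⟨by rw [hm.1], hm.2.symm⟩)
    · simp only [List.cons_append, List.cons.injEq] at hm
      exact .inl ⟨m, by rw [hm.1, hm.2.1], hm.2.2⟩

theorem BStep.pi_eq {D : Dict α} {τ τ' : Tok α} (h : BStep D τ τ') : pi τ' = pi τ := by
  obtain ⟨φ, φ', s, t, -, rfl, rfl⟩ := h
  simp [pi]

theorem BStep.neTok {D : Dict α} {τ τ' : Tok α} (h : BStep D τ τ') (hne : NETok τ) :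
    NETok τ' := by
  obtain ⟨φ, φ', s, t, -, rfl, rfl⟩ := h
  intro x hx
  simp only [List.mem_append, List.mem_cons] at hx
  rcases hx with hx | rfl | hx
  · exact hne x (by simp [hx])
  · simp [hne s (by simp)]
  · exact hne x (by simp [hx])

theorem BStep.length {D : Dict α} {τ τ' : Tok α} (h : BStep D τ τ') :
    τ.length = τ'.length + 1 := by
  obtain ⟨φ, φ', s, t, -, rfl, rfl⟩ := h
  simp; omega

/-- Base rewriting only removes token boundaries. -/
theorem BStep.exists_split {D : Dict α} {τ a b : Tok α} (h : BStep D τ (a ++ b)) :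
    ∃ a' b', τ = a' ++ b' ∧ pi a' = pi a := by
  obtain ⟨φ, φ', s, t, -, rfl, h⟩ := h
  obtain ⟨m, rfl, rfl⟩ | ⟨m, rfl, hm⟩ := List.append_eq_append_iff.1 h
  · exact ⟨a, m ++ s :: t :: φ', by simp, rfl⟩
  · cases m with
    | nil => exact ⟨φ, s :: t :: φ', rfl, by simp⟩
    | cons x m =>
      simp only [List.cons_append, List.cons.injEq] at hm
      obtain ⟨rfl, rfl⟩ := hm
      exact ⟨φ ++ s :: t :: m, b, by simp, by simp [pi]⟩

theorem exists_split_of_bSteps {D : Dict α} {τ a b : Tok α}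
    (h : ReflTransGen (BStep D) τ (a ++ b)) : ∃ a' b', τ = a' ++ b' ∧ pi a' = pi a := by
  induction h using ReflTransGen.head_induction_on with
  | refl => exact ⟨a, b, rfl, rfl⟩
  | head hs _ ih =>
    obtain ⟨a', b', rfl, hpi⟩ := ih
    obtain ⟨a'', b'', rfl, hpi'⟩ := hs.exists_split
    exact ⟨a'', b'', rfl, hpi'.trans hpi⟩

/-- The SentencePiece step on `φ ++ r.1 :: r.2 :: φ'` merges the displayed pair. -/
def NextMerge (D : Dict α) (r : Token α × Token α) (φ φ' : Tok α) : Prop :=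
  ∃ (i : ℕ) (h : i < D.length), D[i]'h = r ∧
    (∀ (j : ℕ) (hj : j < D.length), j < i → ¬ Applies (D[j]'hj) (φ ++ r.1 :: r.2 :: φ')) ∧
    ∀ q < φ.length, ¬ AppliesAt r (φ ++ r.1 :: r.2 :: φ') q

theorem applyAt_append (r : Token α × Token α) (φ φ' : Tok α) :
    applyAt r (φ ++ r.1 :: r.2 :: φ') φ.length = φ ++ (r.1 ++ r.2) :: φ' := by
  simp [applyAt, List.drop_append]

theorem spStep_iff {D : Dict α} {τ τ' : Tok α} :
    SPStep D τ τ' ↔ ∃ r φ φ', NextMerge D r φ φ' ∧ τ = φ ++ r.1 :: r.2 :: φ' ∧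
      τ' = φ ++ (r.1 ++ r.2) :: φ' := by
  constructor
  · rintro ⟨i, _, hi, ⟨φ, φ', rfl, rfl⟩, hj, hq, rfl⟩
    exact ⟨D[i], φ, φ', ⟨i, hi, rfl, hj, hq⟩, rfl, applyAt_append _ _ _⟩
  · rintro ⟨_, φ, φ', ⟨i, hi, rfl, hj, hq⟩, rfl, rfl⟩
    exact ⟨i, φ.length, hi, ⟨φ, φ', rfl, rfl⟩, hj, hq, (applyAt_append _ _ _).symm⟩

theorem NextMerge.spStep {D : Dict α} {r : Token α × Token α} {φ φ' : Tok α}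
    (h : NextMerge D r φ φ') : SPStep D (φ ++ r.1 :: r.2 :: φ') (φ ++ (r.1 ++ r.2) :: φ') :=
  spStep_iff.2 ⟨r, φ, φ', h, rfl, rfl⟩

theorem AppliesAt.extend {r : Token α × Token α} {τ : Tok α} {p : ℕ} (h : AppliesAt r τ p)
    (a b : Tok α) : AppliesAt r (a ++ τ ++ b) (a.length + p) := by
  obtain ⟨φ, φ', rfl, rfl⟩ := h
  exact ⟨a ++ φ, φ' ++ b, by simp, by simp⟩

theorem Applies.extend {r : Token α × Token α} {τ : Tok α} (h : Applies r τ)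
    (a b : Tok α) : Applies r (a ++ τ ++ b) :=
  let ⟨_, hp⟩ := h
  ⟨_, hp.extend a b⟩

/-- The next merge of a tokenization is the next merge of every factor containing it. -/
theorem NextMerge.restrict {D : Dict α} {r : Token α × Token α} {a φ φ' b : Tok α}
    (h : NextMerge D r (a ++ φ) (φ' ++ b)) : NextMerge D r φ φ' := by
  obtain ⟨i, hi, hr, hj, hq⟩ := h
  have e : a ++ φ ++ r.1 :: r.2 :: (φ' ++ b) = a ++ (φ ++ r.1 :: r.2 :: φ') ++ b := by simp
  rw [e] at hj hq
  exact ⟨i, hi, hr, fun j hjD hji ha => hj j hjD hji (ha.extend a b),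
    fun q hlt ha => hq _ (by simpa using hlt) (ha.extend a b)⟩

theorem NextMerge.restrict_left {D : Dict α} {r : Token α × Token α} {φ φ' b : Tok α}
    (h : NextMerge D r φ (φ' ++ b)) : NextMerge D r φ φ' :=
  NextMerge.restrict (a := []) h

theorem NextMerge.restrict_right {D : Dict α} {r : Token α × Token α} {a φ φ' : Tok α}
    (h : NextMerge D r (a ++ φ) φ') : NextMerge D r φ φ' :=
  NextMerge.restrict (b := []) (by simpa using h)

theorem SPStep.bStep {D : Dict α} {τ τ' : Tok α} (h : SPStep D τ τ') : BStep D τ τ' := by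
  obtain ⟨r, φ, φ', ⟨i, hi, rfl, -⟩, rfl, rfl⟩ := spStep_iff.1 h
  exact ⟨φ, φ', D[i].1, D[i].2, List.getElem_mem hi, rfl, rfl⟩

theorem SPStep.unique {D : Dict α} {τ σ σ' : Tok α} (h : SPStep D τ σ) (h' : SPStep D τ σ') :
    σ = σ' := by
  obtain ⟨i, p, hi, ha, hj, hq, rfl⟩ := h
  obtain ⟨i', p', hi', ha', hj', hq', rfl⟩ := h'
  obtain hlt | rfl | hlt := lt_trichotomy i i'
  · exact absurd ⟨p, ha⟩ (hj' i hi hlt)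
  · obtain hlt | rfl | hlt := lt_trichotomy p p'
    · exact absurd ha (hq' p hlt)
    · rfl
    · exact absurd ha' (hq p' hlt)
  · exact absurd ⟨p', ha'⟩ (hj i' hi' hlt)

theorem exists_spStep_of_applies {D : Dict α} {τ : Tok α} {r : Token α × Token α} (hr : r ∈ D)
    (h : Applies r τ) : ∃ τ', SPStep D τ τ' := by
  classical
  obtain ⟨k, hk, rfl⟩ := List.getElem_of_mem hr
  have hex : ∃ i, ∃ hi : i < D.length, Applies (D[i]'hi) τ := ⟨k, hk, h⟩
  obtain ⟨hi, hp⟩ := Nat.find_spec hex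
  exact ⟨_, Nat.find hex, Nat.find hp, hi, Nat.find_spec hp,
    fun j hj hlt ha => Nat.find_min hex hlt ⟨hj, ha⟩, fun q hq => Nat.find_min hp hq, rfl⟩

theorem not_spStep_of_extend {D : Dict α} {a τ b : Tok α}
    (h : ∀ τ', ¬ SPStep D (a ++ τ ++ b) τ') (τ' : Tok α) : ¬ SPStep D τ τ' := by
  rintro ⟨i, p, hi, ha, -⟩
  obtain ⟨σ, hσ⟩ := exists_spStep_of_applies (List.getElem_mem hi) (Applies.extend ⟨p, ha⟩ a b)
  exact h σ hσ

theorem spSteps_of_spStep {D : Dict α} {τ σ ρ : Tok α} (h : ReflTransGen (SPStep D) τ ρ)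
    (hρ : ∀ τ', ¬ SPStep D ρ τ') (hs : SPStep D τ σ) : ReflTransGen (SPStep D) σ ρ := by
  obtain rfl | ⟨σ', hs', h'⟩ := h.cases_head
  · exact absurd hs (hρ _)
  · exact hs.unique hs' ▸ h'

theorem pi_eq_of_spSteps {D : Dict α} {τ τ' : Tok α} (h : ReflTransGen (SPStep D) τ τ') :
    pi τ' = pi τ := by
  induction h with
  | refl => rfl
  | tail _ hs ih => exact hs.bStep.pi_eq.trans ih

theorem neTok_of_spSteps {D : Dict α} {τ τ' : Tok α} (h : ReflTransGen (SPStep D) τ τ')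
    (hne : NETok τ) : NETok τ' := by
  induction h with
  | refl => exact hne
  | tail _ hs ih => exact hs.bStep.neTok ih

/-- A boundary that survives to the end of a run is never merged across. -/
theorem not_spSteps_of_straddle {D : Dict α} {φ φ' a b : Tok α} {s t : Token α}
    (hs : s ≠ []) (ht : t ≠ []) (hpi : pi (φ ++ [s]) = pi a) :
    ¬ ReflTransGen (SPStep D) (φ ++ (s ++ t) :: φ') (a ++ b) := by
  intro h
  obtain ⟨c, d, hcd, hc⟩ := exists_split_of_bSteps
    (ReflTransGen.mono (fun _ _ => SPStep.bStep) _ _ h)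
  have hlen := congrArg List.length (hc.trans hpi.symm)
  have hs' := List.length_pos_of_ne_nil hs
  have ht' := List.length_pos_of_ne_nil ht
  obtain ⟨m, rfl, hm⟩ | ⟨m, rfl, -⟩ := List.append_eq_append_iff.1 hcd
  · cases m with
    | nil =>
      simp only [pi_append, pi_cons, List.length_append, List.append_nil] at hlen
      omega
    | cons x m =>
      obtain ⟨rfl, -⟩ := List.cons.inj hm
      simp only [pi_append, pi_cons, List.length_append] at hlen
      simp [pi] at hlen
      omega
  · simp only [pi_append, pi_cons, List.length_append] at hlen
    omega

/-- A run of SentencePiece steps restricts to both sides of a boundary that survives it. -/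
theorem spSteps_split {D : Dict α} {a b a' b' : Tok α}
    (h : ReflTransGen (SPStep D) (a ++ b) (a' ++ b')) (hne : NETok (a ++ b))
    (hpi : pi a = pi a') :
    ReflTransGen (SPStep D) a a' ∧ ReflTransGen (SPStep D) b b' := by
  generalize hτ : a ++ b = τ at h
  induction h using ReflTransGen.head_induction_on generalizing a b with
  | refl =>
    obtain ⟨rfl, rfl⟩ := eq_of_append_eq_append_of_pi_eq hne hτ hpi
    exact ⟨.refl, .refl⟩
  | head hs hrun ih =>
    have hne' := hs.bStep.neTok (hτ ▸ hne)
    obtain ⟨r, φ, φ', hn, rfl, rfl⟩ := spStep_iff.1 hs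
    obtain ⟨m, rfl, rfl⟩ | ⟨rfl, rfl⟩ | ⟨m, rfl, rfl⟩ := pair_append_cases hτ
    · have hstep := hn.restrict_left.spStep
      have := ih (a := φ ++ (r.1 ++ r.2) :: m) (b := b) (by simpa using hne')
        (hstep.bStep.pi_eq.trans hpi) (by simp)
      exact ⟨.head hstep this.1, this.2⟩
    · exact absurd hrun (not_spSteps_of_straddle (hne _ (by simp)) (hne _ (by simp)) hpi)
    · have hstep := hn.restrict_right.spStep
      have := ih (a := a) (b := m ++ (r.1 ++ r.2) :: φ') (by simpa using hne') hpi (by simp)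
      exact ⟨this.1, .head hstep this.2⟩

/-- Two runs that agree on a nonempty overlap `y`, and that never merge across its ends,
combine into one run. -/
theorem spSteps_glue {D : Dict α} {τ ω : Tok α} {u : Token α}
    (hτ : ∀ σ, ¬ SPStep D (τ ++ [u]) σ) (hω : ∀ σ, ¬ SPStep D (u :: ω) σ)
    {x y z : Tok α} (hy : y ≠ []) (hne : NETok (x ++ (y ++ z)))
    (hx : pi x = pi τ) (hyu : pi y = pi [u])
    (hxy : ReflTransGen (SPStep D) (x ++ y) (τ ++ [u]))
    (hyz : ReflTransGen (SPStep D) (y ++ z) (u :: ω)) :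
    ReflTransGen (SPStep D) (x ++ (y ++ z)) (τ ++ u :: ω) ∧
      ∀ σ, ¬ SPStep D (τ ++ u :: ω) σ := by
  induction hl : (x ++ (y ++ z)).length generalizing x y z with
  | zero => simp [hy] at hl
  | succ n ih =>
    by_cases hstuck : ∀ σ, ¬ SPStep D (x ++ (y ++ z)) σ
    · have hxy' : x ++ y = τ ++ [u] := hxy.cases_head.resolve_right fun ⟨σ, hs, _⟩ =>
        absurd hs (not_spStep_of_extend (a := []) (b := z) (by simpa using hstuck) σ)
      have hyz' : y ++ z = u :: ω := hyz.cases_head.resolve_right fun ⟨σ, hs, _⟩ =>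
        absurd hs (not_spStep_of_extend (a := x) (b := []) (by simpa using hstuck) σ)
      obtain ⟨rfl, rfl⟩ := eq_of_append_eq_append_of_pi_eq
        ((neTok_append (a := x ++ y) (b := z)).1 (by simpa using hne)).1 hxy' hx
      rw [hyz'] at hstuck ⊢
      exact ⟨.refl, hstuck⟩
    · push Not at hstuck
      obtain ⟨σ, hs⟩ := hstuck
      have hne' := hs.bStep.neTok hne
      have hlen := hs.bStep.length
      rw [hl] at hlen
      suffices H : ReflTransGen (SPStep D) σ (τ ++ u :: ω) ∧ ∀ σ, ¬ SPStep D (τ ++ u :: ω) σ from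
        ⟨.head hs H.1, H.2⟩
      obtain ⟨r, φ, φ', hn, hpair, rfl⟩ := spStep_iff.1 hs
      obtain ⟨m, rfl, rfl⟩ | ⟨rfl, hb⟩ | ⟨m, rfl, hb⟩ := pair_append_cases hpair
      · have hstep := hn.restrict_left.spStep
        have hstep' := NextMerge.spStep (D := D) (r := r) (φ := φ) (φ' := m ++ y)
          (NextMerge.restrict_left (b := z) (by simpa using hn))
        simpa using ih (x := φ ++ (r.1 ++ r.2) :: m) (y := y) (z := z) hy (by simpa using hne')
          (hstep.bStep.pi_eq.trans hx) hyu
          (by simpa using spSteps_of_spStep hxy hτ (by simpa using hstep')) hyz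
          (by simp at hlen ⊢; omega)
      · obtain ⟨t, y, rfl⟩ := List.exists_cons_of_ne_nil hy
        simp only [List.cons_append, List.cons.injEq] at hb
        obtain ⟨rfl, rfl⟩ := hb
        refine absurd (spSteps_of_spStep hxy hτ ?_)
          (not_spSteps_of_straddle (φ' := y) (hne r.1 (by simp)) (hne r.2 (by simp)) hx)
        simpa using hn.restrict_left.spStep
      · obtain ⟨m', rfl, rfl⟩ | ⟨rfl, rfl⟩ | ⟨m', rfl, rfl⟩ := pair_append_cases hb
        · have hstep := hn.restrict.spStep
          have hstep₁ := hn.restrict_left.spStep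
          have hstep₂ := hn.restrict_right.spStep
          simpa using ih (x := x) (y := m ++ (r.1 ++ r.2) :: m') (z := z) (by simp)
            (by simpa using hne') hx (hstep.bStep.pi_eq.trans hyu)
            (by simpa using spSteps_of_spStep hxy hτ (by simpa using hstep₁))
            (by simpa using spSteps_of_spStep hyz hω (by simpa using hstep₂))
            (by simp at hlen ⊢; omega)
        · refine absurd (spSteps_of_spStep hyz hω ?_) (not_spSteps_of_straddle (φ' := φ') (a := [u])
            (hne r.1 (by simp)) (hne r.2 (by simp)) hyu)
          simpa using hn.restrict_right.spStep
        · have hstep := NextMerge.spStep (D := D) (r := r) (φ := m') (φ' := φ')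
            (NextMerge.restrict_right (a := x ++ y) (by simpa using hn))
          have hstep' := hn.restrict_right.spStep
          simpa using ih (x := x) (y := y) (z := m' ++ (r.1 ++ r.2) :: φ') hy
            (by simpa using hne') hx hyu hxy
            (by simpa using spSteps_of_spStep hyz hω (by simpa using hstep'))
            (by simp at hlen ⊢; omega)

theorem IsSP.pi_eq {D : Dict α} {w : List α} {τ : Tok α} (h : IsSP D w τ) : pi τ = w :=
  (pi_eq_of_spSteps h.1).trans (pi_tkEmpty w)

theorem IsSP.neTok {D : Dict α} {w : List α} {τ : Tok α} (h : IsSP D w τ) : NETok τ :=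
  neTok_of_spSteps h.1 (neTok_tkEmpty w)

/-- Both parts of a SentencePiece tokenization are SentencePiece tokenizations. -/
theorem IsSP.split {D : Dict α} {w : List α} {a b : Tok α} (h : IsSP D w (a ++ b)) :
    IsSP D (pi a) a ∧ IsSP D (pi b) b := by
  have hrun := h.1
  rw [← h.pi_eq, pi_append, tkEmpty_append] at hrun
  obtain ⟨ha, hb⟩ := spSteps_split hrun (by rw [← tkEmpty_append]; exact neTok_tkEmpty _)
    (pi_tkEmpty _)
  exact ⟨⟨ha, not_spStep_of_extend (a := []) (b := b) h.2⟩,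
    ⟨hb, not_spStep_of_extend (a := a) (b := []) (by simpa using h.2)⟩⟩

theorem IsSP.glue {D : Dict α} {v w : List α} {u : Token α} {τ₁ τ₂ φ₁ φ₂ : Tok α}
    (h1 : IsSP D v (τ₁ ++ u :: τ₂)) (h2 : IsSP D w (φ₁ ++ u :: φ₂)) :
    IsSP D (pi (τ₁ ++ u :: φ₂)) (τ₁ ++ u :: φ₂) := by
  have hu : u ≠ [] := h1.neTok u (by simp)
  obtain ⟨hl, hl'⟩ := (IsSP.split (a := τ₁ ++ [u]) (b := τ₂) (by simpa using h1)).1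
  obtain ⟨hr, hr'⟩ := h2.split.2
  rw [pi_append, tkEmpty_append] at hl
  rw [pi_cons, tkEmpty_append] at hr
  have e : TkEmpty (pi (τ₁ ++ u :: φ₂)) = TkEmpty (pi τ₁) ++ (TkEmpty u ++ TkEmpty (pi φ₂)) := by
    rw [pi_append, pi_cons, tkEmpty_append, tkEmpty_append]
  have := spSteps_glue hl' hr' (x := TkEmpty (pi τ₁)) (y := TkEmpty u) (z := TkEmpty (pi φ₂))
    (by simpa [TkEmpty] using hu) (e ▸ neTok_tkEmpty _) (pi_tkEmpty _)
    (by rw [pi_tkEmpty]; simp [pi]) (by simpa [pi] using hl) hr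
  exact ⟨e ▸ this.1, this.2⟩

/-- If `𝕋^D(v) = τ₁⌢u⌢τ₂` and `𝕋^D(w) = φ₁⌢u⌢φ₂`, then
`𝕋^D(π(τ₁⌢u⌢φ₂)) = τ₁⌢u⌢φ₂` and `𝕋^D(π(φ₁⌢u⌢τ₂)) = φ₁⌢u⌢τ₂`. -/
theorem sp_glue (D : Dict α) (hD : NEDict D) (v w : List α) (u : Token α)
    (τ₁ τ₂ φ₁ φ₂ : Tok α)
    (h1 : IsSP D v (τ₁ ++ u :: τ₂)) (h2 : IsSP D w (φ₁ ++ u :: φ₂)) :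
    IsSP D (pi (τ₁ ++ u :: φ₂)) (τ₁ ++ u :: φ₂) ∧
      IsSP D (pi (φ₁ ++ u :: τ₂)) (φ₁ ++ u :: τ₂) :=
  ⟨h1.glue h2, h2.glue h1⟩
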